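/- Let t ≥ 0 be an integer, let H be a graph containing no t+2 pairwise vertex-disjoint triangles, and let (T, M, I) be a tiling triple of H with |T| = t+1. Let xyz ∈ T be a triangle. If e1 and e2 are distinct edges of M, e1 sees the vertex w1 of xyz and e2 sees the vertex w2 of xyz (w1, w2 ∈ {x,y,z}), then w1 = w2. In particular, if an edge uv ∈ M sees the vertex x of xyz, then every other edge of M that sees xyz sees only x of xyz. -/

import Mathlib

open Finset

/-- `H` contains `k` pairwise vertex-disjoint triangles. -/
def HasKDisjointTriangles {n : ℕ} (H : SimpleGraph (Fin n)) (k : ℕ) : Prop :=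
  ∃ T : Finset (Finset (Fin n)), T.card = k ∧ (∀ s ∈ T, H.IsNClique 3 s) ∧
    (T : Set (Finset (Fin n))).Pairwise fun s₁ s₂ => Disjoint s₁ s₂

/-- The edge `e` (a set of two vertices) sees the vertex `w` of the triangle `s`:
`w ∈ s` and both endpoints of `e` are adjacent to `w` in `H`. -/
def seesAt {n : ℕ} (H : SimpleGraph (Fin n)) (e s : Finset (Fin n)) (w : Fin n) : Prop :=
  w ∈ s ∧ ∀ u ∈ e, H.Adj u w

/-- `(T, M, I)` is a tiling triple of `H`: `T` is a family of pairwise vertex-disjoint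
triangles, `M` is a matching, `I` is an independent set, and `V(T), V(M), I` partition
the vertex set. -/
def IsTilingTriple {n : ℕ} (H : SimpleGraph (Fin n)) (T M : Finset (Finset (Fin n)))
    (I : Finset (Fin n)) : Prop :=
  (∀ s ∈ T, H.IsNClique 3 s) ∧ (∀ e ∈ M, H.IsNClique 2 e) ∧
  (∀ x ∈ I, ∀ y ∈ I, ¬ H.Adj x y) ∧
  (((T ∪ M : Finset (Finset (Fin n))) : Set (Finset (Fin n))).Pairwise
    fun s₁ s₂ => Disjoint s₁ s₂) ∧
  Disjoint ((T ∪ M).biUnion id) I ∧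
  (T ∪ M).biUnion id ∪ I = Finset.univ

/-- Replacing a triangle of a disjoint family by two triangles that are disjoint from each
other and from the rest of the family gives one more disjoint triangle. -/
theorem HasKDisjointTriangles.of_replace {n : ℕ} {H : SimpleGraph (Fin n)}
    {T : Finset (Finset (Fin n))} {s a b : Finset (Fin n)}
    (hT : ∀ r ∈ T, H.IsNClique 3 r)
    (hdisj : (T : Set (Finset (Fin n))).Pairwise fun s₁ s₂ => Disjoint s₁ s₂)
    (hs : s ∈ T) (ha : H.IsNClique 3 a) (hb : H.IsNClique 3 b) (hab : Disjoint a b)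
    (haT : ∀ r ∈ T, r ≠ s → Disjoint a r) (hbT : ∀ r ∈ T, r ≠ s → Disjoint b r) :
    HasKDisjointTriangles H (T.card + 1) := by
  have ne_of_disjoint : ∀ {c d : Finset (Fin n)}, H.IsNClique 3 c → Disjoint c d → c ≠ d := by
    rintro c d hc hcd rfl
    have h := hc.card_eq
    rw [(disjoint_self_iff_empty _).mp hcd] at h
    simp at h
  have hb_not : b ∉ T.erase s := fun h =>
    ne_of_disjoint hb (hbT b (mem_of_mem_erase h) (ne_of_mem_erase h)) rfl
  have ha_not : a ∉ insert b (T.erase s) := fun h => by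
    rcases mem_insert.mp h with h | h
    · exact ne_of_disjoint ha hab h
    · exact ne_of_disjoint ha (haT a (mem_of_mem_erase h) (ne_of_mem_erase h)) rfl
  refine ⟨insert a (insert b (T.erase s)), ?_, ?_, ?_⟩
  · rw [card_insert_of_notMem ha_not, card_insert_of_notMem hb_not, card_erase_add_one hs]
  · intro r hr
    simp only [mem_insert, mem_erase] at hr
    rcases hr with rfl | rfl | ⟨-, hr⟩
    exacts [ha, hb, hT r hr]
  · intro p hp q hq hpq
    simp only [mem_coe, mem_insert, mem_erase] at hp hq
    rcases hp with rfl | rfl | ⟨hps, hp⟩ <;> rcases hq with rfl | rfl | ⟨hqs, hq⟩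
    · exact absurd rfl hpq
    · exact hab
    · exact haT q hq hqs
    · exact hab.symm
    · exact absurd rfl hpq
    · exact hbT q hq hqs
    · exact (haT p hp hps).symm
    · exact (hbT p hp hps).symm
    · exact hdisj hp hq hpq

/-- An edge together with a vertex it sees is a triangle. -/
theorem seesAt.isNClique_insert {n : ℕ} {H : SimpleGraph (Fin n)} {e s : Finset (Fin n)}
    {w : Fin n} (he : H.IsNClique 2 e) (h : seesAt H e s w) : H.IsNClique 3 (insert w e) :=
  he.insert fun u hu => (h.2 u hu).symm

/-- Claim 4.6. If `H` has no `t+2` pairwise vertex-disjoint triangles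
and `(T, M, I)` is a tiling triple of `H` with `|T| = t+1`, then any two distinct edges
of `M` seeing a triangle `s ∈ T` see the same vertex of `s`. -/
theorem statement14 (n t : ℕ) (H : SimpleGraph (Fin n))
    (hfree : ¬ HasKDisjointTriangles H (t + 2))
    (T M : Finset (Finset (Fin n))) (I : Finset (Fin n))
    (htiling : IsTilingTriple H T M I) (hT : T.card = t + 1)
    (s : Finset (Fin n)) (hs : s ∈ T)
    (e₁ : Finset (Fin n)) (he₁ : e₁ ∈ M) (e₂ : Finset (Fin n)) (he₂ : e₂ ∈ M)
    (hne : e₁ ≠ e₂) (w₁ w₂ : Fin n)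
    (hsee₁ : seesAt H e₁ s w₁) (hsee₂ : seesAt H e₂ s w₂) :
    w₁ = w₂ := by
  obtain ⟨hT3, hM2, -, hdisj, -, -⟩ := htiling
  by_contra hw
  have disj_TM : ∀ r ∈ T, ∀ e ∈ M, Disjoint r e := fun r hr e he =>
    hdisj (mem_union_left _ hr) (mem_union_right _ he) fun h => by
      have h3 := (hT3 r hr).card_eq
      have h2 := (hM2 e he).card_eq
      rw [h] at h3
      omega
  have hTdisj : (T : Set (Finset (Fin n))).Pairwise fun s₁ s₂ => Disjoint s₁ s₂ :=
    hdisj.mono (coe_subset.mpr subset_union_left)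
  have hedisj : Disjoint e₁ e₂ :=
    hdisj (mem_union_right _ he₁) (mem_union_right _ he₂) hne
  have insert_disj : ∀ e ∈ M, ∀ w ∈ s, ∀ r ∈ T, r ≠ s → Disjoint (insert w e) r :=
    fun e he w hws r hr hrs => disjoint_insert_left.mpr
      ⟨disjoint_left.mp (hTdisj hs hr hrs.symm) hws, (disj_TM r hr e he).symm⟩
  have hab : Disjoint (insert w₁ e₁) (insert w₂ e₂) := by
    refine disjoint_insert_left.mpr ⟨fun h => ?_, disjoint_insert_right.mpr
      ⟨disjoint_left.mp (disj_TM s hs e₁ he₁) hsee₂.1, hedisj⟩⟩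
    exact (mem_insert.mp h).elim hw (disjoint_left.mp (disj_TM s hs e₂ he₂) hsee₁.1)
  apply hfree
  have h := HasKDisjointTriangles.of_replace hT3 hTdisj hs
    (hsee₁.isNClique_insert (hM2 e₁ he₁)) (hsee₂.isNClique_insert (hM2 e₂ he₂)) hab
    (insert_disj e₁ he₁ w₁ hsee₁.1) (insert_disj e₂ he₂ w₂ hsee₂.1)
  rwa [hT] at h
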